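/- Let γ ∈ (0,1), c : S × S → ℝ, and α ∈ [0,1]. For every policy π and transition kernel U and every fixed player policy π_pl, the series defining the entropy-regularized return J_H(π_pl; π, U) converges absolutely; moreover, for every pair of policies π_pl, π_op, J_H(π_pl; π_pl, T^α[π_op]) = J_H(π_pl; π_mix, T), where π_mix is the mixed policy of π_pl and π_op. -/

import Mathlib

open Finset

/-- A policy: nonnegative and sums to one over actions at every state. -/
def IsPolicy {S A : Type*} [Fintype A] (π : S → A → ℝ) : Prop :=
  (∀ s a, 0 ≤ π s a) ∧ ∀ s, ∑ a, π s a = 1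

/-- A transition kernel: nonnegative and sums to one over next states. -/
def IsKernel {S A : Type*} [Fintype S] (U : S → A → S → ℝ) : Prop :=
  (∀ s a s', 0 ≤ U s a s') ∧ ∀ s a, ∑ s', U s a s' = 1

/-- An initial distribution over states. -/
def IsDist {S : Type*} [Fintype S] (P0 : S → ℝ) : Prop :=
  (∀ s, 0 ≤ P0 s) ∧ ∑ s, P0 s = 1

/-- The perturbed kernel `T^α[π_op]`. -/
def perturb {S A : Type*} [Fintype A] (T : S → A → S → ℝ) (πop : S → A → ℝ) (α : ℝ) :
    S → A → S → ℝ :=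
  fun s a s' => α * T s a s' + (1 - α) * ∑ b, πop s b * T s b s'

/-- The mixed policy `α·π_pl + (1−α)·π_op`. -/
def mix {S A : Type*} (πpl πop : S → A → ℝ) (α : ℝ) : S → A → ℝ :=
  fun s a => α * πpl s a + (1 - α) * πop s a

/-- The time-`t` state marginal of the Markov chain induced by policy `π` and kernel `U`
started at `P0`. -/
def marg {S A : Type*} [Fintype S] [Fintype A] (P0 : S → ℝ) (π : S → A → ℝ)
    (U : S → A → S → ℝ) : ℕ → S → ℝ
  | 0 => P0
  | t + 1 => fun s' => ∑ s, marg P0 π U t s * ∑ a, π s a * U s a s'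

/-- Shannon entropy of a finitely supported action distribution, with the convention
`0 · log 0 = 0` (which holds since `Real.log 0 = 0`). -/
noncomputable def shannonEntropy {A : Type*} [Fintype A] (p : A → ℝ) : ℝ :=
  -∑ a, p a * Real.log (p a)

/-- The entropy-regularized return of policy `π` under kernel `U`, where the entropy is that of
the fixed player policy `πpl`:
`J_H(πpl; π, U) = ∑_t γ^t ∑_s p_t(s) (−H(πpl s) + ∑_{s'} (∑_a π s a · U s a s') c(s,s'))`. -/
noncomputable def entReturn {S A : Type*} [Fintype S] [Fintype A]
    (γ : ℝ) (c : S → S → ℝ) (P0 : S → ℝ) (πpl : S → A → ℝ)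
    (π : S → A → ℝ) (U : S → A → S → ℝ) : ℝ :=
  ∑' t : ℕ, γ ^ t * ∑ s, marg P0 π U t s *
    (-shannonEntropy (πpl s) + ∑ s', (∑ a, π s a * U s a s') * c s s')

theorem marg_isDist {S A : Type*} [Fintype S] [Fintype A] {P0 : S → ℝ} (hP0 : IsDist P0)
    {π : S → A → ℝ} (hπ : IsPolicy π) {U : S → A → S → ℝ} (hU : IsKernel U) (t : ℕ) :
    IsDist (marg P0 π U t) := by
  induction t with
  | zero => exact hP0
  | succ t ih =>
    refine ⟨fun s' => ?_, ?_⟩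
    · exact Finset.sum_nonneg fun s _ => mul_nonneg (ih.1 s)
        (Finset.sum_nonneg fun a _ => mul_nonneg (hπ.1 s a) (hU.1 s a s'))
    · have h : ∀ s, ∑ s', ∑ a, π s a * U s a s' = 1 := by
        intro s
        rw [Finset.sum_comm]
        simp only [← Finset.mul_sum, hU.2, mul_one, hπ.2]
      simp only [marg]
      rw [Finset.sum_comm]
      simp only [← Finset.mul_sum, h, mul_one, ih.2]

theorem step_eq {S A : Type*} [Fintype A] (T : S → A → S → ℝ) (α : ℝ)
    (πpl πop : S → A → ℝ) (h : IsPolicy πpl) (s s' : S) :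
    ∑ a, πpl s a * perturb T πop α s a s' = ∑ a, mix πpl πop α s a * T s a s' := by
  simp only [perturb, mix, mul_add, add_mul, Finset.sum_add_distrib]
  rw [← Finset.sum_mul, h.2, one_mul, Finset.mul_sum]
  congr 1
  · exact Finset.sum_congr rfl fun a _ => by ring
  · exact Finset.sum_congr rfl fun a _ => by ring

theorem marg_eq {S A : Type*} [Fintype S] [Fintype A] (P0 : S → ℝ) (T : S → A → S → ℝ) (α : ℝ)
    (πpl πop : S → A → ℝ) (h : IsPolicy πpl) (t : ℕ) :
    marg P0 πpl (perturb T πop α) t = marg P0 (mix πpl πop α) T t := by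
  induction t with
  | zero => rfl
  | succ t ih =>
    funext s'
    simp only [marg, ih, step_eq T α πpl πop h]

/-- The series defining the entropy-regularized return converges absolutely, and the
entropy-regularized returns of the player policy under the perturbed kernel and of the mixed
policy under the original kernel coincide. -/
theorem ent_return_equivalence {S A : Type*} [Fintype S] [Fintype A] [Nonempty S] [Nonempty A]
    (T : S → A → S → ℝ) (hT : IsKernel T)
    (P0 : S → ℝ) (hP0 : IsDist P0)
    (γ : ℝ) (hγ : γ ∈ Set.Ioo (0 : ℝ) 1) (c : S → S → ℝ)
    (α : ℝ) (hα : α ∈ Set.Icc (0 : ℝ) 1) :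
    (∀ (πpl π : S → A → ℝ) (U : S → A → S → ℝ), IsPolicy πpl → IsPolicy π → IsKernel U →
        Summable (fun t : ℕ => |γ ^ t * ∑ s, marg P0 π U t s *
          (-shannonEntropy (πpl s) + ∑ s', (∑ a, π s a * U s a s') * c s s')|)) ∧
      ∀ (πpl πop : S → A → ℝ), IsPolicy πpl → IsPolicy πop →
        entReturn γ c P0 πpl πpl (perturb T πop α)
          = entReturn γ c P0 πpl (mix πpl πop α) T := by
  refine ⟨fun πpl π U _ hπ hU => ?_, fun πpl πop hpl _ => ?_⟩
  · generalize hf : (fun s => -shannonEntropy (πpl s) + ∑ s', (∑ a, π s a * U s a s') * c s s') = f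
    have hf' : ∀ s, -shannonEntropy (πpl s) + ∑ s', (∑ a, π s a * U s a s') * c s s' = f s :=
      fun s => congrFun hf s
    simp only [hf']
    refine Summable.of_nonneg_of_le (fun t => abs_nonneg _) (fun t => ?_)
      ((summable_geometric_of_lt_one hγ.1.le hγ.2).mul_right (∑ s, |f s|))
    rw [abs_mul, abs_of_nonneg (pow_nonneg hγ.1.le t)]
    refine mul_le_mul_of_nonneg_left ?_ (pow_nonneg hγ.1.le t)
    refine (Finset.abs_sum_le_sum_abs _ _).trans (Finset.sum_le_sum fun s _ => ?_)
    have hd := marg_isDist hP0 hπ hU t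
    have h1 : marg P0 π U t s ≤ 1 := by
      rw [← hd.2]
      exact Finset.single_le_sum (fun i _ => hd.1 i) (Finset.mem_univ s)
    rw [abs_mul, abs_of_nonneg (hd.1 s)]
    exact mul_le_of_le_one_left (abs_nonneg _) h1
  · simp only [entReturn, marg_eq P0 T α πpl πop hpl, step_eq T α πpl πop hpl]
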